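/- arXiv:2103.02473 — 4 statements merged into one kernel-verified Lean document; each statement's English description precedes it below -/
import Mathlib

section
/- Let V be an n-dimensional real vector space and A an endomorphism of V. Then for every 0 ≤ r ≤ n, tr(A^2 ∘ T_r(A)) = σ_1(A)·σ_{r+1}(A) − (r + 2)·σ_{r+2}(A). -/
open Polynomial

namespace Matrix

variable {n K : Type*} [Fintype n] [DecidableEq n]

lemma eval_det_one_add_X_smul [CommRing K] (M : Matrix n n K) (t : K) :
    (det (1 + (X : K[X]) • M.map C)).eval t = det (1 + t • M) := by
  rw [eval_det]
  congr 1
  ext i j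
  simp [Matrix.one_apply, mul_comm]

/-- The coefficients of the adjugate of `1 + X M` are the Newton transformations of `M`. -/
lemma coeff_adjugate_one_add_X_smul [CommRing K] (M : Matrix n n K) (k : ℕ) :
    (adjugate (1 + (X : K[X]) • M.map C)).map (coeff · k) =
      ∑ j ∈ Finset.range (k + 1),
        ((-1) ^ j * (det (1 + (X : K[X]) • M.map C)).coeff (k - j)) • M ^ j := by
  set B := 1 + (X : K[X]) • M.map C with hB
  have hmul : adjugate B + (X : K[X]) • (M.map C * adjugate B) = det B • 1 := by
    rw [← mul_adjugate B]
    nth_rw 3 [hB]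
    rw [add_mul, one_mul, smul_mul_assoc]
  induction k with
  | zero =>
    ext i j
    have h := congrArg (coeff · 0) (congrFun₂ hmul i j)
    simpa [Matrix.one_apply, apply_ite (coeff · 0)] using h
  | succ k ih =>
    have hrec : (adjugate B).map (coeff · (k + 1)) =
        (det B).coeff (k + 1) • 1 - M * (adjugate B).map (coeff · k) := by
      rw [eq_sub_iff_add_eq]
      ext i j
      have h := congrArg (coeff · (k + 1)) (congrFun₂ hmul i j)
      simp only [Matrix.add_apply, Matrix.smul_apply, smul_eq_mul, coeff_add, coeff_X_mul,
        Matrix.mul_apply, Matrix.map_apply, finsetSum_coeff, coeff_C_mul] at h ⊢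
      rw [h]
      rw [Matrix.one_apply, Matrix.one_apply]
      split_ifs <;> simp
    rw [hrec, ih, Finset.sum_range_succ' _ (k + 1), Finset.mul_sum, sub_eq_neg_add, ← Finset.sum_neg_distrib]
    congr 1
    · refine Finset.sum_congr rfl fun j _ => ?_
      rw [mul_smul_comm, ← pow_succ', ← neg_smul, Nat.add_sub_add_right]
      congr 1
      ring
    · simp

/-- Jacobi's formula for the derivative of `det (1 + X M)`. -/
lemma derivative_det_one_add_X_smul_eq_trace [Field K] [Infinite K] (M : Matrix n n K) :
    derivative (det (1 + (X : K[X]) • M.map C)) =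
      trace (adjugate (1 + (X : K[X]) • M.map C) * M.map C) := by
  set p := det (1 + (X : K[X]) • M.map C) with hp
  have hp0 : p ≠ 0 := by
    intro h
    have h0 := eval_det_one_add_X_smul M 0
    rw [← hp, h] at h0
    simp at h0
  refine mul_left_cancel₀ hp0 (Polynomial.funext fun t => ?_)
  rw [eval_mul, eval_mul]
  by_cases ht : p.eval t = 0
  · rw [ht, zero_mul, zero_mul]
  congr 1
  have hpt : p.eval t = det (1 + t • M) := eval_det_one_add_X_smul M t
  have hunit : IsUnit (det (1 + t • M)) := by
    rw [← hpt]; exact isUnit_iff_ne_zero.mpr ht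
  have htaylor : taylor t p =
      C (det (1 + t • M)) * det (1 + (X : K[X]) • ((1 + t • M)⁻¹ * M).map C) := by
    refine Polynomial.funext fun s => ?_
    rw [taylor_eval, eval_mul, eval_C, eval_det_one_add_X_smul, eval_det_one_add_X_smul,
      ← det_mul, mul_add, mul_one, mul_smul_comm, mul_nonsing_inv_cancel_left _ _ hunit,
      add_smul]
    congr 1
    abel
  have hadj : (adjugate (1 + (X : K[X]) • M.map C)).map (eval t) = adjugate (1 + t • M) := by
    rw [← coe_evalRingHom]
    change (evalRingHom t).mapMatrix _ = _
    rw [RingHom.map_adjugate]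
    congr 1
    ext i j
    simp [Matrix.one_apply, apply_ite (eval t), mul_comm (M i j)]
  have htrace : (trace (adjugate (1 + (X : K[X]) • M.map C) * M.map C)).eval t =
      trace (adjugate (1 + t • M) * M) := by
    rw [← hadj]
    simp [trace, Matrix.mul_apply, eval_finsetSum]
  rw [← taylor_coeff_one, htaylor, coeff_C_mul, coeff_det_one_add_X_smul_one, htrace,
    Matrix.inv_def, smul_mul_assoc, trace_smul, smul_eq_mul, ← mul_assoc,
    Ring.mul_inverse_cancel _ hunit, one_mul]

/-- Newton's identity `tr (T k (M) M) = (k + 1) σ (k + 1)`. -/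
lemma trace_newton_transformation_mul [Field K] [Infinite K] (M : Matrix n n K) (k : ℕ) :
    ∑ j ∈ Finset.range (k + 1),
        (-1) ^ j * (det (1 + (X : K[X]) • M.map C)).coeff (k - j) * trace (M ^ (j + 1)) =
      ((k : K) + 1) * (det (1 + (X : K[X]) • M.map C)).coeff (k + 1) := by
  have h := congrArg (coeff · k) (derivative_det_one_add_X_smul_eq_trace M)
  have hc : (trace (adjugate (1 + (X : K[X]) • M.map C) * M.map C)).coeff k =
      trace ((adjugate (1 + (X : K[X]) • M.map C)).map (coeff · k) * M) := by
    simp [trace, Matrix.mul_apply]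
  simp only [hc, coeff_derivative] at h
  rw [coeff_adjugate_one_add_X_smul, Finset.sum_mul, trace_sum] at h
  rw [mul_comm, h]
  refine Finset.sum_congr rfl fun j _ => ?_
  rw [smul_mul_assoc, trace_smul, smul_eq_mul, pow_succ]

end Matrix

/-- For the Newton transformations `T r (A) = ∑_{j=0}^r (-1)^j σ (r-j) • A^j` of an
endomorphism `A` of an `n`-dimensional real vector space, one has
`tr (A² ∘ T r (A)) = σ 1 * σ (r+1) - (r + 2) σ (r+2)` for every `0 ≤ r ≤ n`, where
`σ r` is defined by `det (id + t • A) = ∑_{r=0}^n σ r * t ^ r`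
(and `σ r = 0` for `r > n`). -/
theorem trace_sq_comp_newton_transformation
    (n : ℕ) (V : Type*) [AddCommGroup V] [Module ℝ V] [FiniteDimensional ℝ V]
    (hV : Module.finrank ℝ V = n)
    (A : Module.End ℝ V) (σ : ℕ → ℝ)
    (hdef : ∀ t : ℝ,
      LinearMap.det (1 + t • A) = ∑ r ∈ Finset.range (n + 1), σ r * t ^ r)
    (hzero : ∀ r : ℕ, n < r → σ r = 0) :
    ∀ r : ℕ, r ≤ n →
      LinearMap.trace ℝ V
          (A ^ 2 * ∑ j ∈ Finset.range (r + 1), ((-1 : ℝ) ^ j * σ (r - j)) • A ^ j)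
        = σ 1 * σ (r + 1) - ((r : ℝ) + 2) * σ (r + 2) := by
  intro r _
  let b := Module.finBasis ℝ V
  set M := LinearMap.toMatrix b b A with hM
  set p := Matrix.det (1 + (X : ℝ[X]) • M.map C) with hp
  have hpσ : p = ∑ i ∈ Finset.range (n + 1), C (σ i) * X ^ i := by
    refine Polynomial.funext fun t => ?_
    rw [hp, Matrix.eval_det_one_add_X_smul, hM, ← LinearMap.toMatrix_one b, ← map_smul,
      ← map_add, LinearMap.det_toMatrix, hdef]
    simp [eval_finsetSum]
  have hcoeff (k : ℕ) : p.coeff k = σ k := by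
    rw [hpσ]
    simp only [finsetSum_coeff, coeff_C_mul_X_pow, Finset.sum_ite_eq, Finset.mem_range]
    split_ifs with hk
    · rfl
    · exact (hzero k (by omega)).symm
  have htr (k : ℕ) : Matrix.trace (M ^ k) = LinearMap.trace ℝ V (A ^ k) := by
    rw [LinearMap.trace_eq_matrix_trace ℝ b, LinearMap.toMatrix_pow]
  have h1 := Matrix.trace_newton_transformation_mul M 0
  have h := Matrix.trace_newton_transformation_mul M (r + 1)
  have h0 : σ 0 = 1 := by simpa [Finset.sum_range_succ'] using (hdef 0).symm
  simp only [← hp, hcoeff, htr] at h h1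
  simp only [zero_add, Finset.sum_range_one, pow_zero, one_mul, pow_one, Nat.sub_self, h0,
    Nat.cast_zero] at h1
  rw [Finset.sum_range_succ'] at h
  simp only [pow_zero, one_mul, zero_add, pow_one, Nat.sub_zero, h1,
    Nat.add_sub_add_right] at h
  have hsum : LinearMap.trace ℝ V
      (A ^ 2 * ∑ j ∈ Finset.range (r + 1), ((-1 : ℝ) ^ j * σ (r - j)) • A ^ j) =
      -∑ j ∈ Finset.range (r + 1),
        (-1) ^ (j + 1) * σ (r - j) * LinearMap.trace ℝ V (A ^ (j + 1 + 1)) := by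
    rw [Finset.mul_sum, map_sum, ← Finset.sum_neg_distrib]
    refine Finset.sum_congr rfl fun j _ => ?_
    rw [mul_smul_comm, map_smul, ← pow_add, smul_eq_mul, show 2 + j = j + 1 + 1 by omega]
    ring
  rw [hsum]
  push_cast at h
  linear_combination -h
end

section
/- Let V be an n-dimensional real vector space, let A : ℝ → End(V) be a map that is differentiable at t_0 with derivative A', and let 1 ≤ r ≤ n. Then the function t ↦ σ_r(A(t)) is differentiable at t_0 with derivative tr(T_{r−1}(A(t_0)) ∘ A'). (This is the operator-curve form of the identity tr(T_{r−1}(A)(∇_X A)) = X(σ_r).) -/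
/-- **Jacobi's formula**, for a matrix whose entries are differentiable at a point. -/
theorem Matrix.hasDerivAt_det {ι : Type*} [Fintype ι] [DecidableEq ι]
    {M : ℝ → Matrix ι ι ℝ} {M' : Matrix ι ι ℝ} {t₀ : ℝ}
    (hM : ∀ i j, HasDerivAt (fun t => M t i j) (M' i j) t₀) :
    HasDerivAt (fun t => (M t).det) ((M t₀).adjugate * M').trace t₀ := by
  have key : ((M t₀).adjugate * M').trace = ∑ π : Equiv.Perm ι, ((Equiv.Perm.sign π : ℤ) : ℝ) *
      ∑ i, (∏ j ∈ Finset.univ.erase i, M t₀ (π j) j) • M' (π i) i := by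
    have h : ∀ i, ((M t₀).adjugate * M') i i = ((M t₀).updateCol i (fun k => M' k i)).det := by
      intro i
      rw [← Matrix.cramer_apply, Matrix.cramer_eq_adjugate_mulVec]
      rfl
    simp only [Matrix.trace, Matrix.diag_apply, h, Matrix.det_apply', Finset.mul_sum]
    rw [Finset.sum_comm]
    refine Finset.sum_congr rfl fun π _ => Finset.sum_congr rfl fun i _ => ?_
    rw [← Finset.prod_erase_mul _ _ (Finset.mem_univ i), Matrix.updateCol_self, smul_eq_mul]
    congr 2
    refine Finset.prod_congr rfl fun j hj => ?_
    rw [Matrix.updateCol_ne (Finset.ne_of_mem_erase hj)]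
  rw [key]
  simp only [Matrix.det_apply']
  exact HasDerivAt.fun_sum fun π _ =>
    (HasDerivAt.fun_finsetProd fun i _ => hM (π i) i).const_mul _

/-- If the values of a curve of polynomials of bounded degree are differentiable at every point,
then so are its coefficients. -/
theorem hasDerivAt_coeff_of_hasDerivAt_sum {N : ℕ} {c : ℝ → ℕ → ℝ} {d : ℕ → ℝ} {t₀ : ℝ}
    (h : ∀ s : ℝ, HasDerivAt (fun t => ∑ k ∈ Finset.range N, c t k * s ^ k)
      (∑ k ∈ Finset.range N, d k * s ^ k) t₀) {k : ℕ} (hk : k < N) :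
    HasDerivAt (fun t => c t k) (d k) t₀ := by
  let W : Matrix (Fin N) (Fin N) ℝ := Matrix.vandermonde fun i => (i : ℝ)
  have hW : IsUnit W.det := by
    rw [isUnit_iff_ne_zero, Matrix.det_vandermonde_ne_zero_iff]
    intro i j hij
    exact Fin.ext (Nat.cast_injective (R := ℝ) hij)
  have inv : ∀ e : ℕ → ℝ, e k = ∑ i : Fin N, W⁻¹ ⟨k, hk⟩ i *
      ∑ l ∈ Finset.range N, e l * ((i : ℕ) : ℝ) ^ l := by
    intro e
    have h1 : W⁻¹.mulVec (W.mulVec fun l : Fin N => e l) = fun l : Fin N => e l := by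
      rw [Matrix.mulVec_mulVec, Matrix.nonsing_inv_mul _ hW, Matrix.one_mulVec]
    have h2 := congrFun h1 ⟨k, hk⟩
    refine h2.symm.trans ?_
    simp only [Matrix.mulVec, dotProduct]
    refine Finset.sum_congr rfl fun i _ => ?_
    rw [Finset.sum_range]
    congr 1
    exact Finset.sum_congr rfl fun l _ => mul_comm _ _
  rw [inv d, funext fun t => inv (c t)]
  exact HasDerivAt.fun_sum fun i _ => (h i).const_mul _

open Polynomial in
/-- The coefficients of `adjugate (1 + X • B)` are the Newton transformations of `B`. -/
theorem Matrix.coeff_adjugate_one_add_X_smul_s7 {ι R : Type*} [Fintype ι] [DecidableEq ι]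
    [CommRing R] (B : Matrix ι ι R) (k : ℕ) :
    (Matrix.of fun i j => ((1 + (X : R[X]) • B.map C).adjugate i j).coeff k) =
      ∑ j ∈ Finset.range (k + 1),
        ((-1) ^ j * (1 + (X : R[X]) • B.map C).det.coeff (k - j)) • B ^ j := by
  set P : Matrix ι ι R[X] := 1 + (X : R[X]) • B.map C with hP
  have hmul : ∀ i j, P.adjugate i j + X * ∑ l, C (B i l) * P.adjugate l j =
      P.det * (1 : Matrix ι ι R[X]) i j := by
    intro i j
    have h := congrFun (congrFun P.mul_adjugate i) j
    conv_lhs at h => rw [hP, Matrix.add_mul, Matrix.one_mul, Matrix.smul_mul, ← hP]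
    simpa [Matrix.mul_apply] using h
  have hone : ∀ i j m, (P.det * (1 : Matrix ι ι R[X]) i j).coeff m =
      P.det.coeff m * (1 : Matrix ι ι R) i j := by
    intro i j m
    by_cases hij : i = j <;> simp [Matrix.one_apply, hij]
  induction k with
  | zero =>
    ext i j
    have h := congrArg (coeff · 0) (hmul i j)
    simp only [hone, coeff_add, coeff_X_mul_zero, add_zero] at h
    simpa using h
  | succ k ih =>
    have h1 : (Matrix.of fun i j => (P.adjugate i j).coeff (k + 1)) =
        P.det.coeff (k + 1) • (1 : Matrix ι ι R) -
          B * Matrix.of fun i j => (P.adjugate i j).coeff k := by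
      ext i j
      have h := congrArg (coeff · (k + 1)) (hmul i j)
      simp only [hone, coeff_add, coeff_X_mul, finsetSum_coeff, coeff_C_mul] at h
      simp only [Matrix.of_apply, Matrix.sub_apply, Matrix.smul_apply, Matrix.mul_apply,
        smul_eq_mul]
      exact eq_sub_of_add_eq h
    rw [h1, ih, Finset.sum_range_succ' _ (k + 1), Finset.mul_sum, sub_eq_neg_add, ← Finset.sum_neg_distrib]
    congr 1
    · refine Finset.sum_congr rfl fun j _ => ?_
      rw [Matrix.mul_smul, ← pow_succ', ← neg_smul, Nat.add_sub_add_right]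
      congr 1
      ring
    · simp

open Polynomial in
/-- The derivative of the elementary symmetric functions along a curve of matrices. -/
theorem Matrix.hasDerivAt_coeff_det_one_add_smul {ι : Type*} [Fintype ι] [DecidableEq ι]
    {n : ℕ} {M : ℝ → Matrix ι ι ℝ} {M' : Matrix ι ι ℝ} {t₀ : ℝ}
    (hM : ∀ i j, HasDerivAt (fun t => M t i j) (M' i j) t₀) {σ : ℝ → ℕ → ℝ}
    (hσ : ∀ t s, (1 + s • M t).det = ∑ k ∈ Finset.range (n + 1), σ t k * s ^ k)
    (hzero : ∀ t k, n < k → σ t k = 0) (r : ℕ) :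
    HasDerivAt (fun t => σ t (r + 1))
      ((∑ j ∈ Finset.range (r + 1), ((-1) ^ j * σ t₀ (r - j)) • M t₀ ^ j) * M').trace t₀ := by
  set P : Matrix ι ι ℝ[X] := 1 + (X : ℝ[X]) • (M t₀).map C with hP
  have hPs : ∀ s : ℝ, (evalRingHom s).mapMatrix P = 1 + s • M t₀ := by
    intro s
    ext i j
    by_cases hij : i = j <;> simp [hP, hij, mul_comm s]
  have hcoeff : ∀ k, P.det.coeff k = σ t₀ k := by
    have h : P.det = ∑ k ∈ Finset.range (n + 1), C (σ t₀ k) * X ^ k := by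
      refine Polynomial.funext fun s => ?_
      rw [← coe_evalRingHom, RingHom.map_det, hPs, hσ]
      simp
    intro k
    rw [h, finsetSum_coeff]
    simp only [coeff_C_mul_X_pow, Finset.sum_ite_eq, Finset.mem_range]
    split_ifs with hk
    · rfl
    · exact (hzero t₀ k (by omega)).symm
  let q : ℝ[X] := X * (P.adjugate * M'.map C).trace
  let N := n + 1 + (q.natDegree + 1) + (r + 2)
  have hq : ((∑ j ∈ Finset.range (r + 1), ((-1) ^ j * σ t₀ (r - j)) • M t₀ ^ j) * M').trace =
      q.coeff (r + 1) := by
    have h := Matrix.coeff_adjugate_one_add_X_smul_s7 (M t₀) r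
    simp only [← hP, hcoeff] at h
    rw [← h]
    simp [q, Matrix.trace, Matrix.mul_apply]
  rw [hq]
  refine hasDerivAt_coeff_of_hasDerivAt_sum (N := N) (d := q.coeff) (fun s => ?_) (by omega)
  have hleft : ∀ t, ∑ k ∈ Finset.range N, σ t k * s ^ k = (1 + s • M t).det := by
    intro t
    rw [hσ]
    refine (Finset.sum_subset (Finset.range_mono (by omega)) fun k _ hk => ?_).symm
    rw [hzero t k (by simpa using hk), zero_mul]
  have hright : ∑ k ∈ Finset.range N, q.coeff k * s ^ k =
      ((1 + s • M t₀).adjugate * (s • M')).trace := by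
    rw [← eval_eq_sum_range' (show q.natDegree < N by omega), ← hPs, ← RingHom.map_adjugate]
    simp [q, Matrix.trace, Matrix.mul_apply, eval_finsetSum, Finset.mul_sum]
  simp only [hleft, hright]
  refine Matrix.hasDerivAt_det fun i j => ?_
  simpa using ((hM i j).const_mul s).const_add ((1 : Matrix ι ι ℝ) i j)


/-- Operator-curve form of `tr (T_{r-1}(A) ∘ ∇_X A) = X (σ_r)`: if a curve
`A : ℝ → End(V)` of endomorphisms of an `n`-dimensional real vector space has
derivative `A'` at `t₀`, then `t ↦ σ r (A t)` is differentiable at `t₀` with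
derivative `tr (T_{r-1}(A t₀) ∘ A')`, for `1 ≤ r ≤ n`.  Here `σ B r` is defined
by `det (id + t • B) = ∑_{r=0}^n σ B r * t ^ r` (and `σ B r = 0` for `r > n`),
and `T_{r-1}(B) = ∑_{j=0}^{r-1} (-1)^j σ B (r-1-j) • B^j`. -/
theorem hasDerivAt_sigma_of_hasDerivAt
    (n : ℕ) (V : Type*) [NormedAddCommGroup V] [NormedSpace ℝ V]
    [FiniteDimensional ℝ V] (hV : Module.finrank ℝ V = n)
    (σ : (V →L[ℝ] V) → ℕ → ℝ)
    (hdef : ∀ B : V →L[ℝ] V, ∀ t : ℝ,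
      LinearMap.det ((1 + t • B : V →L[ℝ] V) : V →ₗ[ℝ] V)
        = ∑ r ∈ Finset.range (n + 1), σ B r * t ^ r)
    (hzero : ∀ B : V →L[ℝ] V, ∀ r : ℕ, n < r → σ B r = 0)
    (A : ℝ → (V →L[ℝ] V)) (A' : V →L[ℝ] V) (t₀ : ℝ)
    (hA : HasDerivAt A A' t₀)
    (r : ℕ) (hr1 : 1 ≤ r) (hrn : r ≤ n) :
    HasDerivAt (fun t => σ (A t) r)
      (LinearMap.trace ℝ V
        (((∑ j ∈ Finset.range r, ((-1 : ℝ) ^ j * σ (A t₀) (r - 1 - j)) • (A t₀) ^ j)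
            * A' : V →L[ℝ] V) : V →ₗ[ℝ] V)) t₀ := by
  obtain ⟨r, rfl⟩ : ∃ k, r = k + 1 := ⟨r - 1, by omega⟩
  let b := Module.finBasis ℝ V
  let Φ : (V →L[ℝ] V) →ₐ[ℝ] Matrix _ _ ℝ :=
    (LinearMap.toMatrixAlgEquiv b).toAlgHom.comp
      { ContinuousLinearMap.toLinearMapRingHom with commutes' := fun _ => rfl }
  have hΦ : ∀ B : V →L[ℝ] V, Φ B = LinearMap.toMatrix b b (B : V →ₗ[ℝ] V) := fun _ => rfl
  have hM : ∀ i j, HasDerivAt (fun t => Φ (A t) i j) (Φ A' i j) t₀ := fun i j =>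
    (LinearMap.toContinuousLinearMap
      ((Matrix.entryLinearMap ℝ ℝ i j).comp Φ.toLinearMap)).hasFDerivAt.comp_hasDerivAt t₀ hA
  have hσ : ∀ t s, (1 + s • Φ (A t)).det =
      ∑ k ∈ Finset.range (n + 1), σ (A t) k * s ^ k := by
    intro t s
    rw [← hdef, ← LinearMap.det_toMatrix b, ← hΦ, map_add, map_one, map_smul]
  have h := Matrix.hasDerivAt_coeff_det_one_add_smul hM hσ (fun t => hzero (A t)) r
  rw [LinearMap.trace_eq_matrix_trace ℝ b, ← hΦ]
  simpa only [map_mul, map_sum, map_smul, map_pow, Nat.add_sub_cancel] using h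
end

section
/- For all natural numbers n ≥ 2 and 1 ≤ r ≤ n, the following identity of real numbers holds: ∑_{j=1}^r (−1)^{j−1}·((n − r + j)/n)·C(n, r − j) = C(n−2, r−1), where C(·,·) denotes binomial coefficients. -/
/-- Partial alternating sums of a row of Pascal's triangle, normalized to end with a positive sign. -/
theorem sum_range_neg_one_pow_sub_mul_choose {R : Type*} [CommRing R] (m s : ℕ) :
    ∑ k ∈ Finset.range (s + 1), (-1 : R) ^ (s - k) * ((m + 1).choose k : R) = (m.choose s : R) := by
  induction s with
  | zero => simp
  | succ s ih =>
    have h : ∑ k ∈ Finset.range (s + 1), (-1 : R) ^ (s + 1 - k) * ((m + 1).choose k : R)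
        = -(m.choose s : R) := by
      rw [← ih, ← Finset.sum_neg_distrib]
      refine Finset.sum_congr rfl fun k hk => ?_
      rw [Nat.succ_sub (Finset.mem_range_succ_iff.mp hk), pow_succ]
      ring
    rw [Finset.sum_range_succ, h, Nat.choose_succ_succ]
    push_cast
    simp

/-- The absorption identity `(n - k) / n * C(n, k) = C(n - 1, k)`, with `n = m + 1`. -/
theorem sub_div_mul_choose_succ {K : Type*} [Field K] [CharZero K] {m k : ℕ} (hk : k ≤ m + 1) :
    (((m + 1 : ℕ) : K) - k) / ((m + 1 : ℕ) : K) * ((m + 1).choose k : K) = (m.choose k : K) := by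
  have h : ((m + 1 : ℕ) : K) ≠ 0 := Nat.cast_ne_zero.mpr m.succ_ne_zero
  have e : (m.choose k : K) * ((m + 1 : ℕ) : K)
      = ((m + 1).choose k : K) * (((m + 1 : ℕ) : K) - k) := by
    rw [← Nat.cast_sub hk]
    exact_mod_cast Nat.choose_mul_succ_eq m k
  rw [div_mul_eq_mul_div, div_eq_iff h, e, mul_comm]

/-- For natural numbers `2 ≤ n` and `1 ≤ r ≤ n`, the identity of real numbers
`∑_{j=1}^r (-1)^(j-1) * ((n - r + j)/n) * C(n, r-j) = C(n-2, r-1)` holds. -/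
theorem alternating_sum_binomial_shifted
    (n r : ℕ) (hn : 2 ≤ n) (hr1 : 1 ≤ r) (hrn : r ≤ n) :
    (∑ j ∈ Finset.Icc 1 r,
        (-1 : ℝ) ^ (j - 1) * (((n : ℝ) - r + j) / n) * (n.choose (r - j) : ℝ))
      = ((n - 2).choose (r - 1) : ℝ) := by
  obtain ⟨m, rfl⟩ := Nat.exists_eq_add_of_le' hn
  obtain ⟨s, rfl⟩ := Nat.exists_eq_add_of_le' hr1
  rw [Nat.add_sub_cancel, Nat.add_sub_cancel, ← sum_range_neg_one_pow_sub_mul_choose]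
  refine Finset.sum_nbij' (fun j => s + 1 - j) (fun k => s + 1 - k) ?_ ?_ ?_ ?_ fun j hj => ?_
  iterate 4 simp only [Finset.mem_Icc, Finset.mem_range]; omega
  rw [Finset.mem_Icc] at hj
  rw [← sub_div_mul_choose_succ (K := ℝ) (m := m + 1) (k := s + 1 - j) (by omega),
    Nat.cast_sub hj.2, show s - (s + 1 - j) = j - 1 by omega, mul_assoc, sub_add]
end

section
/- Let n ≥ 1 be a natural number, c, V ∈ ℝ, and let x : ℕ → ℝ satisfy: x(0) = V, x(1) = 0, x(r) = 0 for all r > n, and (r + 2)·x(r+2) = c·((n : ℝ) − r)·x(r) for every r ≥ 0. Then: (i) x(r) = 0 for every odd r; (ii) if n = 2l is even, then x(2s) = c^s·C(l, s)·V for every s ≥ 0, where C(l, s) denotes the binomial coefficient; (iii) if n is odd, then x(r) = 0 for every even r ≥ 2. -/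
theorem cast_choose_succ_mul (l s : ℕ) :
    (l.choose (s + 1) : ℝ) * (s + 1) = l.choose s * ((l : ℝ) - s) := by
  rcases le_or_gt s l with h | h
  · rw [← Nat.cast_sub h]
    exact_mod_cast Nat.choose_succ_right_eq l s
  · simp [Nat.choose_eq_zero_of_lt h, Nat.choose_eq_zero_of_lt (Nat.lt_succ_of_lt h)]


/-- The arithmetic core of the computation of total `r`-th mean curvatures:
if `x : ℕ → ℝ` satisfies `x 0 = V`, `x 1 = 0`, `x r = 0` for `r > n`, and the
recursion `(r + 2) * x (r+2) = c * (n - r) * x r` for all `r ≥ 0`, then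
(i) `x r = 0` for all odd `r`;
(ii) if `n = 2l` then `x (2s) = c^s * C(l, s) * V` for all `s`;
(iii) if `n` is odd then `x r = 0` for all even `r ≥ 2`. -/
theorem total_mean_curvature_recursion
    (n : ℕ) (hn : 1 ≤ n) (c V : ℝ) (x : ℕ → ℝ)
    (h0 : x 0 = V) (h1 : x 1 = 0)
    (htop : ∀ r : ℕ, n < r → x r = 0)
    (hrec : ∀ r : ℕ, ((r : ℝ) + 2) * x (r + 2) = c * ((n : ℝ) - (r : ℝ)) * x r) :
    (∀ r : ℕ, Odd r → x r = 0)
    ∧ (∀ l : ℕ, n = 2 * l →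
        ∀ s : ℕ, x (2 * s) = c ^ s * (l.choose s : ℝ) * V)
    ∧ (Odd n → ∀ r : ℕ, Even r → 2 ≤ r → x r = 0) := by
  refine ⟨?_, ?_, ?_⟩
  · rintro r ⟨k, rfl⟩
    induction k with
    | zero => exact h1
    | succ k ih =>
      have h := hrec (2 * k + 1)
      rw [ih, mul_zero] at h
      exact (mul_eq_zero.mp h).resolve_left (by positivity)
  · rintro l rfl s
    induction s with
    | zero => simp [h0]
    | succ s ih =>
      have h := hrec (2 * s)
      rw [ih] at h
      have hc := cast_choose_succ_mul l s
      have hs : (2 * (s : ℝ) + 2) ≠ 0 := by positivity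
      apply mul_left_cancel₀ hs
      push_cast at h
      rw [show 2 * (s + 1) = 2 * s + 2 by ring, h, pow_succ]
      linear_combination -2 * c ^ s * c * V * hc
  · intro hodd r hr h2
    by_cases hc : c = 0
    · obtain ⟨k, rfl⟩ := Nat.exists_eq_add_of_le' h2
      have h := hrec k
      rw [hc, zero_mul, zero_mul] at h
      exact (mul_eq_zero.mp h).resolve_left (by positivity)
    · have descend : ∀ k r : ℕ, Even r → n < r + 2 * k → x r = 0 := by
        intro k
        induction k with
        | zero => exact fun r _ h => htop r h
        | succ k ih =>
          intro r hr h
          have hx := hrec r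
          rw [ih (r + 2) (hr.add even_two) (by omega), mul_zero] at hx
          have hne : (n : ℝ) - r ≠ 0 := by
            rw [sub_ne_zero, Ne, Nat.cast_inj]
            rintro rfl
            exact Nat.not_even_iff_odd.mpr hodd hr
          exact (mul_eq_zero.mp hx.symm).resolve_left (mul_ne_zero hc hne)
      exact descend (n + 1) r hr (by omega)
end
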